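/- Let Q be a Quantum Petri net over a reversible net equipped with an involution inv : T → T satisfying F⁻(inv t) = F⁺(t) and F⁺(inv t) = F⁻(t) for every transition t, extended additively to concurrences. If the rate function is conjugate symmetric, i.e. r_{m'}(inv t) = conj(r_m(t)) whenever m →_t m' with m, m' in the reachability set, then the rate matrix R_Q is self-adjoint: its conjugate transpose equals R_Q, so R_Q is a Hermitian operator on the complex Hilbert space ℂ^{R₀}. -/

import Mathlib

/-- A Place-Transition net: flow functions giving each transition its
input and output multiset of places. -/
structure PTN (P T : Type) where
  Fminus : T → Multiset P
  Fplus : T → Multiset P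

namespace PTN

variable {P T : Type} [DecidableEq P]

/-- Input flow of a concurrence (multiset of transitions), extended additively. -/
def inFlow (N : PTN P T) (t : Multiset T) : Multiset P := (t.map N.Fminus).sum

/-- Output flow of a concurrence, extended additively. -/
def outFlow (N : PTN P T) (t : Multiset T) : Multiset P := (t.map N.Fplus).sum

/-- `N.Fires m t m'` : concurrence `t` is enabled at marking `m` and firing it yields `m'`. -/
def Fires (N : PTN P T) (m : Multiset P) (t : Multiset T) (m' : Multiset P) : Prop :=
  N.inFlow t ≤ m ∧ m' = m - N.inFlow t + N.outFlow t

/-- Direct single-transition reachability: firing some concurrence of cardinality 1. -/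
def Step1 (N : PTN P T) (m m' : Multiset P) : Prop :=
  ∃ t : Multiset T, Multiset.card t = 1 ∧ N.Fires m t m'

/-- Reachability set of the system net `(N, M0)`. -/
def ReachSet (N : PTN P T) (M0 : Multiset P) : Set (Multiset P) :=
  {m | Relation.ReflTransGen N.Step1 M0 m}

/-- Entry `R_Q[m', m]` of the rate matrix: sum of `r m t` over all concurrences `t`
with `m →_t m'`. -/
noncomputable def rateEntry (N : PTN P T) (r : Multiset P → Multiset T → ℂ)
    (m m' : Multiset P) : ℂ :=
  ∑ᶠ t ∈ {t : Multiset T | N.Fires m t m'}, r m t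

end PTN

namespace PTN

theorem inFlow_map {P T : Type} (N : PTN P T) {f : T → T}
    (hf : ∀ t, N.Fminus (f t) = N.Fplus t) (t : Multiset T) :
    N.inFlow (t.map f) = N.outFlow t := by
  simp [inFlow, outFlow, Multiset.map_map, hf]

theorem outFlow_map {P T : Type} (N : PTN P T) {f : T → T}
    (hf : ∀ t, N.Fplus (f t) = N.Fminus t) (t : Multiset T) :
    N.outFlow (t.map f) = N.inFlow t := by
  simp [inFlow, outFlow, Multiset.map_map, hf]

/-- Firing the reverse of a concurrence undoes the firing of that concurrence. -/
theorem Fires.reverse {P T : Type} [DecidableEq P] {N : PTN P T} {f : T → T}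
    (hminus : ∀ t, N.Fminus (f t) = N.Fplus t) (hplus : ∀ t, N.Fplus (f t) = N.Fminus t)
    {m m' : Multiset P} {t : Multiset T} (h : N.Fires m t m') :
    N.Fires m' (t.map f) m := by
  obtain ⟨hle, rfl⟩ := h
  rw [Fires, inFlow_map N hminus, outFlow_map N hplus]
  exact ⟨Multiset.le_add_left _ _, by rw [add_tsub_cancel_right, tsub_add_cancel_of_le hle]⟩

end PTN

/-- **QPN rate matrices of reversible nets with conjugate symmetric rates are
Hermitian.** Let `Q` be a QPN over a reversible net equipped with an involution
`inv` on transitions swapping input and output flows. If the rate function is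
conjugate symmetric, i.e. `r_{m'}(inv t) = conj (r_m t)` whenever `m →_t m'` with
`m, m'` in the reachability set, then the rate matrix (indexed by the reachability
set) is self-adjoint, i.e. a Hermitian operator on `ℂ^{R₀}`. -/
theorem rateMatrix_isHermitian {P T : Type} [DecidableEq P]
    (N : PTN P T) (M0 : Multiset P)
    (inv : T → T) (hinv : Function.Involutive inv)
    (hswapMinus : ∀ t : T, N.Fminus (inv t) = N.Fplus t)
    (hswapPlus : ∀ t : T, N.Fplus (inv t) = N.Fminus t)
    (r : Multiset P → Multiset T → ℂ)
    (hfin : ∀ m m' : Multiset P, {t : Multiset T | N.Fires m t m'}.Finite)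
    (hsym : ∀ m m' : Multiset P, ∀ t : Multiset T,
      m ∈ N.ReachSet M0 → m' ∈ N.ReachSet M0 → N.Fires m t m' →
      r m' (t.map inv) = starRingEnd ℂ (r m t))
    (R : Matrix (N.ReachSet M0) (N.ReachSet M0) ℂ)
    (hR : ∀ m' m : N.ReachSet M0, R m' m = N.rateEntry r m.val m'.val) :
    R.IsHermitian := by
  have hmap : Function.Involutive (Multiset.map inv) := fun t => by
    rw [Multiset.map_map, hinv.comp_self, Multiset.map_id]
  ext m m'
  rw [Matrix.conjTranspose_apply, hR, hR, PTN.rateEntry, PTN.rateEntry,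
    ← starRingEnd_apply]
  refine ((starRingEnd ℂ).toAddMonoidHom.map_finsum_mem _ (hfin m.val m'.val)).trans ?_
  refine finsum_mem_eq_of_bijOn (Multiset.map inv) ⟨fun t ht => ?_, hmap.injective.injOn,
    fun t ht => ⟨t.map inv, ?_, hmap t⟩⟩ fun t ht => ?_
  · exact PTN.Fires.reverse hswapMinus hswapPlus ht
  · exact PTN.Fires.reverse hswapMinus hswapPlus ht
  · exact (hsym _ _ t m.2 m'.2 ht).symm
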